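/- (Sparse regime upper bound.) There exists a universal constant C > 0 such that the following holds. Let k, m, s be positive integers with k ≥ m, let ε ∈ (0,1], δ ∈ (0,1), and α ∈ (0,1). If s ≥ C · log(km/α) · ( k/(mα²) + (k/(√m ε α)) √(log(1/δ)) ), then there exists a randomized mechanism A mapping datasets of s users, each holding m samples from [k], to probability measures on Δ_k, such that: (i) A is (ε,δ)-differentially private with respect to user-level adjacency; and (ii) for every p ∈ Δ_k, when each user's m samples are drawn i.i.d. from p, the output p̂ satisfies E[ℓ1(p, p̂)] ≤ α. -/

import Mathlib

open MeasureTheory ProbabilityTheory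
open scoped ENNReal NNReal

/-- The measure on `Fin k` induced by a probability vector `p`. -/
noncomputable def discMeasure {k : ℕ} (p : Fin k → ℝ) : Measure (Fin k) :=
  ∑ i : Fin k, ENNReal.ofReal (p i) • Measure.dirac i

/-- The expectation of `f` under the binomial distribution with `n` trials and success
probability `p`, defined by conditioning on the first trial. -/
noncomputable def binomExp : ℕ → (ℕ → ℝ) → ℝ → ℝ
  | 0, f, _ => f 0
  | n + 1, f, p => p * binomExp n (fun j => f (j + 1)) p + (1 - p) * binomExp n f p

namespace binomExp

lemma succ (n : ℕ) (f : ℕ → ℝ) (p : ℝ) :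
    binomExp (n + 1) f p = p * binomExp n (fun j => f (j + 1)) p + (1 - p) * binomExp n f p := rfl

lemma add (n : ℕ) (f g : ℕ → ℝ) (p : ℝ) :
    binomExp n (fun j => f j + g j) p = binomExp n f p + binomExp n g p := by
  induction n generalizing f g with
  | zero => rfl
  | succ n ih => simp only [binomExp, ih]; ring

lemma const_mul (n : ℕ) (c : ℝ) (f : ℕ → ℝ) (p : ℝ) :
    binomExp n (fun j => c * f j) p = c * binomExp n f p := by
  induction n generalizing f with
  | zero => rfl
  | succ n ih => simp only [binomExp, ih]; ring

lemma const (n : ℕ) (c p : ℝ) : binomExp n (fun _ => c) p = c := by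
  induction n with
  | zero => rfl
  | succ n ih => simp only [binomExp, ih]; ring

lemma sub (n : ℕ) (f g : ℕ → ℝ) (p : ℝ) :
    binomExp n (fun j => f j - g j) p = binomExp n f p - binomExp n g p := by
  have h := add n f (fun j => (-1) * g j) p
  rw [const_mul] at h
  convert h using 2 <;> ring_nf

lemma mono (n : ℕ) {f g : ℕ → ℝ} (h : ∀ j, f j ≤ g j) {p : ℝ} (h0 : 0 ≤ p) (h1 : p ≤ 1) :
    binomExp n f p ≤ binomExp n g p := by
  induction n generalizing f g with
  | zero => exact h 0
  | succ n ih =>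
    exact add_le_add (mul_le_mul_of_nonneg_left (ih fun j => h (j + 1)) h0)
      (mul_le_mul_of_nonneg_left (ih h) (sub_nonneg.2 h1))

lemma natCast (n : ℕ) (p : ℝ) : binomExp n (fun j => (j : ℝ)) p = n * p := by
  induction n with
  | zero => simp [binomExp]
  | succ n ih =>
    simp only [binomExp, Nat.cast_add, Nat.cast_one, add, const, ih]; ring

lemma natCast_sq (n : ℕ) (p : ℝ) :
    binomExp n (fun j => (j : ℝ) ^ 2) p = n * p * (1 - p) + (n * p) ^ 2 := by
  induction n with
  | zero => simp [binomExp]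
  | succ n ih =>
    have h : (fun j : ℕ => ((j + 1 : ℕ) : ℝ) ^ 2) = fun j : ℕ => (j : ℝ) ^ 2 + (2 * (j : ℝ) + 1) := by
      ext j; push_cast; ring
    simp only [binomExp, h, add, const_mul, const, natCast, ih]; push_cast; ring

lemma natCast_sub_sq (n : ℕ) (p : ℝ) :
    binomExp n (fun j => ((j : ℝ) - n * p) ^ 2) p = n * p * (1 - p) := by
  have h : (fun j : ℕ => ((j : ℝ) - n * p) ^ 2) =
      fun j : ℕ => (j : ℝ) ^ 2 + ((-2 * (n * p)) * (j : ℝ) + (n * p) ^ 2) := by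
    ext j; ring
  rw [h, add, add, const_mul, const, natCast, natCast_sq]; ring

lemma hasDerivAt (n : ℕ) (f : ℕ → ℝ) (p : ℝ) :
    HasDerivAt (binomExp (n + 1) f) ((n + 1) * binomExp n (fun j => f (j + 1) - f j) p) p := by
  induction n generalizing f with
  | zero =>
    have h : binomExp 1 f = fun p => p * f 1 + (1 - p) * f 0 := by ext q; simp [binomExp]
    rw [zero_add, h]
    refine (((hasDerivAt_id p).mul_const (f 1)).add
      (((hasDerivAt_const p (1 : ℝ)).sub (hasDerivAt_id p)).mul_const (f 0))).congr_deriv ?_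
    simp only [binomExp, Nat.cast_zero]
    ring
  | succ n ih =>
    have h := ((hasDerivAt_id p).mul (ih fun j => f (j + 1))).add
      (((hasDerivAt_const p (1 : ℝ)).sub (hasDerivAt_id p)).mul (ih f))
    refine h.congr_deriv ?_
    simp only [id, Pi.sub_apply]
    rw [succ n (fun j => f (j + 1) - f j), sub n (fun j => f (j + 1 + 1)),
      sub n (fun j => f (j + 1)), succ n f, succ n (fun j => f (j + 1))]
    push_cast
    ring

lemma continuous (n : ℕ) (f : ℕ → ℝ) : Continuous (binomExp n f) := by
  induction n generalizing f with
  | zero => exact continuous_const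
  | succ n ih =>
    exact (continuous_id.mul (ih _)).add ((continuous_const.sub continuous_id).mul (ih f))

lemma zero_prob (n : ℕ) (f : ℕ → ℝ) : binomExp n f 0 = f 0 := by
  induction n with
  | zero => rfl
  | succ n ih => simp [binomExp, ih]

lemma one_prob (n : ℕ) (f : ℕ → ℝ) : binomExp n f 1 = f n := by
  induction n generalizing f with
  | zero => rfl
  | succ n ih => simp [binomExp, ih]

end binomExp

/-- The mean of the square root of a binomial variable. -/
noncomputable def sqrtMean (m : ℕ) (p : ℝ) : ℝ := binomExp m (fun j => √(j : ℝ)) p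

lemma inv_sqrt_ge_tangent {a x : ℝ} (ha : 0 < a) (hx : 0 < x) :
    (3 - x / a) / (2 * √a) ≤ 1 / √x := by
  obtain ⟨b, hb, rfl⟩ : ∃ b, 0 < b ∧ a = b ^ 2 := ⟨√a, by positivity, (Real.sq_sqrt ha.le).symm⟩
  obtain ⟨y, hy, rfl⟩ : ∃ y, 0 < y ∧ x = y ^ 2 := ⟨√x, by positivity, (Real.sq_sqrt hx.le).symm⟩
  rw [Real.sqrt_sq hb.le, Real.sqrt_sq hy.le, sub_div' (by positivity), div_div,
    div_le_div_iff₀ (by positivity) (by positivity)]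
  have : 0 ≤ (b - y) ^ 2 * (2 * b + y) := by positivity
  nlinarith

lemma sqrt_succ_sub_sqrt_ge {a : ℝ} (ha : 0 < a) (j : ℕ) :
    3 / (4 * √a) - 1 / (4 * √a * a) * ((j : ℝ) + 1) ≤ √((j + 1 : ℕ) : ℝ) - √(j : ℝ) := by
  have h := inv_sqrt_ge_tangent ha (x := (j : ℝ) + 1) (by positivity)
  have hs : 0 < √((j : ℝ) + 1) := by positivity
  have h2 : 1 / √((j : ℝ) + 1) / 2 ≤ √((j : ℝ) + 1) - √(j : ℝ) := by
    rw [div_div, div_le_iff₀ (by positivity)]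
    nlinarith [Real.sq_sqrt (show (0 : ℝ) ≤ (j : ℝ) + 1 by positivity),
      Real.sq_sqrt (show (0 : ℝ) ≤ (j : ℝ) by positivity),
      sq_nonneg (√((j : ℝ) + 1) - √(j : ℝ))]
  have h3 : 3 / (4 * √a) - 1 / (4 * √a * a) * ((j : ℝ) + 1)
      = (3 - ((j : ℝ) + 1) / a) / (2 * √a) / 2 := by
    have : 0 < √a := by positivity
    field_simp; ring
  rw [h3]
  push_cast
  linarith

/-- The mean of the square root of a binomial variable separates parameters. -/
lemma sqrtMean_sub_ge {m : ℕ} (hm : 0 < m) {a b : ℝ} (h0 : 0 ≤ a) (hab : a ≤ b) (h1 : b ≤ 1) :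
    (m : ℝ) * (b - a) ≤ 2 * √(m * b + 1) * (sqrtMean m b - sqrtMean m a) := by
  obtain ⟨n, rfl⟩ : ∃ n, m = n + 1 := ⟨m - 1, by omega⟩
  set c : ℝ := ((n + 1 : ℕ) : ℝ) * b + 1 with hc
  have hcpos : 0 < c := by have : 0 ≤ b := h0.trans hab; positivity
  have hsc : 0 < √c := by positivity
  have hd : ∀ x, HasDerivAt (sqrtMean (n + 1)) _ x := fun x =>
    binomExp.hasDerivAt n (fun j => √(j : ℝ)) x
  have key : ((n + 1 : ℕ) : ℝ) / (2 * √c) * (b - a) ≤ sqrtMean (n + 1) b - sqrtMean (n + 1) a := by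
    refine (convex_Icc a b).mul_sub_le_image_sub_of_le_deriv
      (fun x _ => (hd x).continuousAt.continuousWithinAt)
      (fun x _ => (hd x).differentiableAt.differentiableWithinAt) ?_ a (by simp [hab]) b
      (by simp [hab]) hab
    intro x hx
    rw [interior_Icc] at hx
    have hx0 : 0 ≤ x := h0.trans hx.1.le
    have hx1 : x ≤ 1 := hx.2.le.trans h1
    rw [(hd x).deriv]
    have h2 := binomExp.mono n (fun j => sqrt_succ_sub_sqrt_ge hcpos j) hx0 hx1
    rw [binomExp.sub, binomExp.const, binomExp.const_mul, binomExp.add, binomExp.natCast,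
      binomExp.const] at h2
    have h3 : (n : ℝ) * x + 1 ≤ c := by
      rw [hc]; push_cast
      nlinarith [hx.2, hx0, mul_le_mul_of_nonneg_left hx.2.le (Nat.cast_nonneg (α := ℝ) n)]
    have h4 : 1 / (4 * √c * c) * ((n : ℝ) * x + 1) ≤ 1 / (4 * √c) := by
      calc _ ≤ 1 / (4 * √c * c) * c := by gcongr
        _ = _ := by field_simp
    have h5 : 1 / (2 * √c) = 3 / (4 * √c) - 1 / (4 * √c) := by field_simp; norm_num
    rw [div_eq_mul_one_div, Nat.cast_succ]
    refine mul_le_mul_of_nonneg_left ?_ (by positivity)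
    linarith
  calc _ = 2 * √c * (((n + 1 : ℕ) : ℝ) / (2 * √c) * (b - a)) := by field_simp
    _ ≤ _ := by gcongr

lemma sqrtMean_strictMonoOn {m : ℕ} (hm : 0 < m) : StrictMonoOn (sqrtMean m) (Set.Icc 0 1) := by
  intro a ha b hb hab
  have h := sqrtMean_sub_ge hm ha.1 hab.le hb.2
  have h1 : 0 < (m : ℝ) * (b - a) := by have := sub_pos.2 hab; positivity
  have h2 : 0 < sqrtMean m b - sqrtMean m a :=
    pos_of_mul_pos_right (h1.trans_le h) (by positivity)
  linarith

/-- A monotone inverse of `sqrtMean` on its range, extended by clamping. -/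
lemma exists_monotone_sqrtMean_inverse {m : ℕ} (hm : 0 < m) :
    ∃ ψ : ℝ → ℝ, Monotone ψ ∧ ∀ y, ψ y ∈ Set.Icc (0 : ℝ) 1 ∧
      ∀ x ∈ Set.Icc (0 : ℝ) 1, |sqrtMean m (ψ y) - sqrtMean m x| ≤ |y - sqrtMean m x| := by
  have h0 : sqrtMean m 0 = 0 := by simp [sqrtMean, binomExp.zero_prob]
  have h1 : sqrtMean m 1 = √m := by simp [sqrtMean, binomExp.one_prob]
  have hmono := sqrtMean_strictMonoOn hm
  have hex : ∀ y : ℝ, ∃ x ∈ Set.Icc (0 : ℝ) 1, sqrtMean m x = max 0 (min y (√m)) := by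
    intro y
    have := intermediate_value_Icc (zero_le_one (α := ℝ))
      (binomExp.continuous m (fun j => √(j : ℝ))).continuousOn
    exact this ⟨by rw [← sqrtMean, h0]; exact le_max_left _ _,
      by rw [← sqrtMean, h1]; exact max_le (Real.sqrt_nonneg _) (min_le_right _ _)⟩
  choose ψ hψ hψy using hex
  refine ⟨ψ, fun y z hyz => ?_, fun y => ⟨hψ y, fun x hx => ?_⟩⟩
  · rw [← hmono.le_iff_le (hψ y) (hψ z), hψy, hψy]
    gcongr
  · have hx0 : 0 ≤ sqrtMean m x := h0 ▸ hmono.monotoneOn (by simp) hx hx.1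
    have hx1 : sqrtMean m x ≤ √m := h1 ▸ hmono.monotoneOn hx (by simp) hx.2
    rw [hψy]
    have hx2 : sqrtMean m x = max 0 (min (sqrtMean m x) (√m)) := by
      rw [min_eq_left hx1, max_eq_right hx0]
    conv_lhs => rw [hx2]
    refine (abs_max_sub_max_le_max _ _ _ _).trans ?_
    rw [sub_self, abs_zero, max_eq_right (abs_nonneg _)]
    exact (abs_min_sub_min_le_max _ _ _ _).trans (by simp)

/-- Error propagation through the inverse of `sqrtMean`. -/
lemma abs_sub_le_of_sqrtMean {m : ℕ} (hm : 0 < m) {x q e : ℝ} (hx : x ∈ Set.Icc (0 : ℝ) 1)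
    (hq : q ∈ Set.Icc (0 : ℝ) 1) (he : |sqrtMean m q - sqrtMean m x| ≤ e) :
    |x - q| ≤ 2 / m * (√(m * x + 1) * e) + 4 / m * e ^ 2 := by
  have hm' : (0 : ℝ) < m := by exact_mod_cast hm
  have he0 : 0 ≤ e := (abs_nonneg _).trans he
  set d := |x - q| with hd
  have hd0 : 0 ≤ d := abs_nonneg _
  have key : m * d ≤ 2 * √(m * x + 1 + m * d) * e := by
    rcases le_total x q with h | h
    · have h1 := sqrtMean_sub_ge hm hx.1 h hq.2
      have h2 : d = q - x := by rw [hd, abs_sub_comm, abs_of_nonneg (sub_nonneg.2 h)]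
      rw [h2, show (m : ℝ) * x + 1 + m * (q - x) = m * q + 1 by ring]
      exact h1.trans (mul_le_mul_of_nonneg_left ((le_abs_self _).trans he) (by positivity))
    · have h1 := sqrtMean_sub_ge hm hq.1 h hx.2
      have h2 : d = x - q := by rw [hd, abs_of_nonneg (sub_nonneg.2 h)]
      rw [← h2] at h1
      refine h1.trans ?_
      have h3 : √(m * x + 1) ≤ √(m * x + 1 + m * d) := Real.sqrt_le_sqrt (by nlinarith)
      have h4 : sqrtMean m x - sqrtMean m q ≤ e := by
        rw [abs_sub_comm] at he; exact (le_abs_self _).trans he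
      calc _ ≤ 2 * √(m * x + 1) * e := mul_le_mul_of_nonneg_left h4 (by positivity)
        _ ≤ _ := by gcongr
  have hb : 0 ≤ (m : ℝ) * x + 1 := by have := hx.1; positivity
  have hsq : (m * d) ^ 2 ≤ (2 * (√(m * x + 1) * e)) ^ 2 + 4 * e ^ 2 * (m * d) := by
    calc (m * d) ^ 2 ≤ (2 * √(m * x + 1 + m * d) * e) ^ 2 := by gcongr
      _ = 4 * (√(m * x + 1 + m * d) ^ 2) * e ^ 2 := by ring
      _ = 4 * (√(m * x + 1) ^ 2 + m * d) * e ^ 2 := by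
        rw [Real.sq_sqrt (by positivity), Real.sq_sqrt hb]
      _ = _ := by ring
  have hfin : m * d ≤ 2 * (√(m * x + 1) * e) + 4 * e ^ 2 := by
    have hB : 0 ≤ 2 * (√(m * x + 1) * e) := by positivity
    by_contra! hlt
    nlinarith [mul_pos (sub_pos.2 hlt) (lt_of_le_of_lt (by positivity) hlt), sq_nonneg e,
      mul_nonneg hB (sq_nonneg e)]
  calc d = (m * d) / m := by field_simp
    _ ≤ (2 * (√(m * x + 1) * e) + 4 * e ^ 2) / m := by gcongr
    _ = _ := by ring

lemma sqrt_sub_sqrt_sq_le {a t : ℝ} (ha : 0 < a) (ht : 0 ≤ t) :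
    (√t - √a) ^ 2 ≤ 1 / a * (t - a) ^ 2 := by
  rw [one_div_mul_eq_div, le_div_iff₀ ha]
  have h1 : t - a = (√t - √a) * (√t + √a) := by
    nlinarith [Real.sq_sqrt ht, Real.sq_sqrt ha.le]
  have h2 : a ≤ (√t + √a) ^ 2 := by
    nlinarith [Real.sq_sqrt ha.le, Real.sqrt_nonneg t, Real.sqrt_nonneg a,
      mul_nonneg (Real.sqrt_nonneg t) (Real.sqrt_nonneg a)]
  rw [h1, mul_pow]
  exact mul_le_mul_of_nonneg_left h2 (sq_nonneg _)

/-- The variance of the square root of a binomial variable. -/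
noncomputable def sqrtVar (m : ℕ) (p : ℝ) : ℝ :=
  binomExp m (fun j => (√(j : ℝ) - sqrtMean m p) ^ 2) p

lemma sqrtVar_le_sub_sq (m : ℕ) (p c : ℝ) :
    sqrtVar m p ≤ binomExp m (fun j => (√(j : ℝ) - c) ^ 2) p := by
  have h : ∀ c, binomExp m (fun j => (√(j : ℝ) - c) ^ 2) p
      = binomExp m (fun j => √(j : ℝ) ^ 2) p + (-2 * c * sqrtMean m p + c ^ 2) := by
    intro c
    have h : (fun j : ℕ => (√(j : ℝ) - c) ^ 2) =
        fun j : ℕ => √(j : ℝ) ^ 2 + ((-2 * c) * √(j : ℝ) + c ^ 2) := by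
      ext j; ring
    rw [h, binomExp.add, binomExp.add, binomExp.const_mul, binomExp.const, sqrtMean]
  rw [sqrtVar, h, h]
  nlinarith [sq_nonneg (sqrtMean m p - c)]

lemma sqrtVar_le_mul (m : ℕ) (p : ℝ) : sqrtVar m p ≤ m * p := by
  have h := sqrtVar_le_sub_sq m p 0
  simpa [binomExp.natCast] using h

lemma sqrtVar_le_div (m : ℕ) {p : ℝ} (h0 : 0 ≤ p) (h1 : p ≤ 1) :
    sqrtVar m p ≤ 2 * (m * p) / (m * p + 1) := by
  have hv := sqrtVar_le_mul m p
  have hmp : 0 ≤ (m : ℝ) * p := by positivity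
  rw [le_div_iff₀ (by positivity)]
  rcases hmp.eq_or_lt with h | h
  · rw [← h] at hv ⊢; linarith
  · have hv1 : sqrtVar m p ≤ 1 := by
      refine (sqrtVar_le_sub_sq m p (√(m * p))).trans ?_
      refine (binomExp.mono m (fun j => sqrt_sub_sqrt_sq_le h (Nat.cast_nonneg j)) h0 h1).trans ?_
      rw [binomExp.const_mul, binomExp.natCast_sub_sq]
      calc 1 / (m * p) * (m * p * (1 - p)) = 1 - p := by
            rw [← mul_assoc, one_div_mul_cancel h.ne', one_mul]
        _ ≤ 1 := by linarith
    nlinarith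

lemma isProbabilityMeasure_discMeasure {k : ℕ} {p : Fin k → ℝ} (h0 : ∀ i, 0 ≤ p i)
    (h1 : ∑ i, p i = 1) : IsProbabilityMeasure (discMeasure p) := by
  constructor
  simp only [discMeasure, Measure.coe_finsetSum, Finset.sum_apply, Measure.smul_apply,
    measure_univ, smul_eq_mul, mul_one]
  rw [← ENNReal.ofReal_sum_of_nonneg fun i _ => h0 i, h1, ENNReal.ofReal_one]

lemma integral_discMeasure {k : ℕ} {p : Fin k → ℝ} (h0 : ∀ i, 0 ≤ p i) (f : Fin k → ℝ) :
    ∫ x, f x ∂discMeasure p = ∑ i, p i * f i := by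
  rw [discMeasure, integral_finsetSum_measure fun i _ => by
    exact (integrable_dirac (by simp)).smul_measure ENNReal.ofReal_ne_top]
  simp [integral_smul_measure, h0]

/-- The number of occurrences of the symbol `i` among the samples `ω`. -/
def symbolCount {k m : ℕ} (ω : Fin m → Fin k) (i : Fin k) : ℕ :=
  (Finset.univ.filter fun j => ω j = i).card

lemma sum_symbolCount {k m : ℕ} (ω : Fin m → Fin k) : ∑ i, (symbolCount ω i : ℝ) = m := by
  have h := Finset.card_eq_sum_card_fiberwise (f := ω) (s := Finset.univ) (t := Finset.univ)
    (by simp)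
  simp only [Finset.card_univ, Fintype.card_fin] at h
  exact_mod_cast h.symm

/-- Counts of i.i.d. samples are binomially distributed. -/
lemma integral_symbolCount {k : ℕ} {p : Fin k → ℝ} (h0 : ∀ i, 0 ≤ p i) (h1 : ∑ i, p i = 1)
    (i : Fin k) (m : ℕ) (f : ℕ → ℝ) :
    ∫ ω : Fin m → Fin k, f (symbolCount ω i) ∂(Measure.pi fun _ => discMeasure p)
      = binomExp m f (p i) := by
  have := isProbabilityMeasure_discMeasure h0 h1
  induction m generalizing f with
  | zero => simp [symbolCount, binomExp]
  | succ m ih =>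
    have hmp := measurePreserving_piFinSuccAbove (fun _ : Fin (m + 1) => discMeasure p) 0
    have hcount : ∀ ω : Fin (m + 1) → Fin k, symbolCount ω i =
        (if ω 0 = i then 1 else 0) + symbolCount (fun j => ω (Fin.succ j)) i := by
      intro ω
      rw [symbolCount, Fin.card_filter_univ_succ, symbolCount]
      split_ifs <;> simp [add_comm]
    have hInt : ∫ ω : Fin (m + 1) → Fin k, f (symbolCount ω i)
          ∂(Measure.pi fun _ => discMeasure p)
        = ∫ z : Fin k × (Fin m → Fin k), f ((if z.1 = i then 1 else 0) + symbolCount z.2 i)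
            ∂((discMeasure p).prod (Measure.pi fun _ => discMeasure p)) := by
      rw [← hmp.integral_comp']
      refine integral_congr_ae (Filter.Eventually.of_forall fun ω => ?_)
      simp only [hcount]
      rfl
    rw [hInt, integral_prod _ Integrable.of_finite, integral_discMeasure h0, binomExp.succ,
      ← ih, ← ih, Fintype.sum_eq_add_sum_compl i]
    congr 1
    · simp [add_comm]
    · have h2 : ∀ x ∈ ({i} : Finset (Fin k))ᶜ, p x * ∫ y : Fin m → Fin k,
          f ((if (x, y).1 = i then 1 else 0) + symbolCount (x, y).2 i)
            ∂(Measure.pi fun _ => discMeasure p)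
          = p x * ∫ y : Fin m → Fin k, f (symbolCount y i)
            ∂(Measure.pi fun _ => discMeasure p) := by
        intro x hx
        have : x ≠ i := by simpa using hx
        simp [this]
      rw [Finset.sum_congr rfl h2, ← Finset.sum_mul]
      congr 1
      have := Fintype.sum_eq_add_sum_compl i p
      linarith

/-- The average over the users in `U` of the square roots of their counts of the symbol `i`. -/
noncomputable def sqrtCountAvg {k m s : ℕ} (U : Finset (Fin s)) (D : Fin s → Fin m → Fin k)
    (i : Fin k) : ℝ :=
  ∑ u ∈ U, (U.card : ℝ)⁻¹ * √(symbolCount (D u) i : ℝ)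

lemma integral_sqrtCountAvg_sub_sq {k m s : ℕ} {p : Fin k → ℝ} (h0 : ∀ i, 0 ≤ p i)
    (h1 : ∑ i, p i = 1) {U : Finset (Fin s)} (hU : U.Nonempty) (i : Fin k) :
    ∫ D : Fin s → Fin m → Fin k, (sqrtCountAvg U D i - sqrtMean m (p i)) ^ 2
      ∂(Measure.pi fun _ => Measure.pi fun _ => discMeasure p) = sqrtVar m (p i) / U.card := by
  have := isProbabilityMeasure_discMeasure h0 h1
  have hn : (U.card : ℝ) ≠ 0 := by exact_mod_cast hU.card_pos.ne'
  set P : Measure (Fin m → Fin k) := Measure.pi fun _ => discMeasure p with hP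
  let X : Fin s → (Fin m → Fin k) → ℝ := fun u ω =>
    (if u ∈ U then (U.card : ℝ)⁻¹ else 0) * √(symbolCount ω i : ℝ)
  have hX : ∀ u, MemLp (X u) 2 P := fun u => MemLp.of_discrete
  have hsum : ∀ D : Fin s → Fin m → Fin k,
      sqrtCountAvg U D i = (∑ u, fun D : Fin s → Fin m → Fin k => X u (D u)) D := by
    intro D
    simp [X, sqrtCountAvg, Finset.sum_apply]
  have hmean : ∫ ω, √(symbolCount ω i : ℝ) ∂P = sqrtMean m (p i) :=
    integral_symbolCount h0 h1 i m fun j => √(j : ℝ)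
  have hvar1 : Var[fun ω => √(symbolCount ω i : ℝ); P] = sqrtVar m (p i) := by
    rw [variance_eq_integral (measurable_of_finite _).aemeasurable, hmean]
    exact integral_symbolCount h0 h1 i m fun j => (√(j : ℝ) - sqrtMean m (p i)) ^ 2
  have hE : ∫ D, (∑ u, fun D : Fin s → Fin m → Fin k => X u (D u)) D ∂(Measure.pi fun _ => P)
      = sqrtMean m (p i) := by
    simp only [Finset.sum_apply]
    rw [integral_finsetSum _ fun u _ => Integrable.of_finite]
    have : ∀ u, ∫ D : Fin s → Fin m → Fin k, X u (D u) ∂(Measure.pi fun _ => P)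
        = (if u ∈ U then (U.card : ℝ)⁻¹ else 0) * sqrtMean m (p i) := by
      intro u
      rw [integral_comp_eval (μ := fun _ : Fin s => P) (f := X u)
        (measurable_of_finite _).aestronglyMeasurable, integral_const_mul, hmean]
    simp [this, hn]
  have hV := variance_sum_pi (μ := fun _ : Fin s => P) hX
  rw [variance_eq_integral (measurable_of_finite _).aemeasurable, hE] at hV
  simp only [hsum]
  rw [hV]
  simp only [X, variance_const_mul, hvar1]
  rw [← Finset.sum_mul]
  simp only [ite_pow, ne_eq, OfNat.ofNat_ne_zero, not_false_eq_true, zero_pow,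
    Finset.sum_ite_mem, Finset.univ_inter, Finset.sum_const, nsmul_eq_mul]
  field_simp

/-- Changing one user's samples moves the averages by at most `√(2m) / |U|` in `ℓ2`. -/
lemma sum_sqrtCountAvg_sub_sq_le {k m s : ℕ} (U : Finset (Fin s))
    {D D' : Fin s → Fin m → Fin k} {u : Fin s} (h : ∀ v, v ≠ u → D v = D' v) :
    ∑ i, (sqrtCountAvg U D i - sqrtCountAvg U D' i) ^ 2 ≤ 2 * m / (U.card : ℝ) ^ 2 := by
  by_cases hu : u ∈ U
  · have hdiff : ∀ i, sqrtCountAvg U D i - sqrtCountAvg U D' i = (U.card : ℝ)⁻¹ *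
        (√(symbolCount (D u) i : ℝ) - √(symbolCount (D' u) i : ℝ)) := by
      intro i
      rw [sqrtCountAvg, sqrtCountAvg, ← Finset.sum_sub_distrib, Finset.sum_eq_single u]
      · ring
      · intro v _ hv; rw [h v hv, sub_self]
      · exact fun h => absurd hu h
    have hle : ∀ i, (sqrtCountAvg U D i - sqrtCountAvg U D' i) ^ 2 ≤ ((U.card : ℝ)⁻¹) ^ 2 *
        ((symbolCount (D u) i : ℝ) + symbolCount (D' u) i) := by
      intro i
      rw [hdiff, mul_pow]
      refine mul_le_mul_of_nonneg_left ?_ (by positivity)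
      have h1 := Real.sq_sqrt (Nat.cast_nonneg (α := ℝ) (symbolCount (D u) i))
      have h2 := Real.sq_sqrt (Nat.cast_nonneg (α := ℝ) (symbolCount (D' u) i))
      nlinarith [mul_nonneg (Real.sqrt_nonneg (symbolCount (D u) i : ℝ))
        (Real.sqrt_nonneg (symbolCount (D' u) i : ℝ))]
    refine (Finset.sum_le_sum fun i _ => hle i).trans_eq ?_
    rw [← Finset.mul_sum, Finset.sum_add_distrib, sum_symbolCount, sum_symbolCount]
    ring
  · have : ∀ i, sqrtCountAvg U D i = sqrtCountAvg U D' i := fun i =>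
      Finset.sum_congr rfl fun v hv => by rw [h v (by rintro rfl; exact hu hv)]
    simp only [this, sub_self]
    simp only [ne_eq, OfNat.ofNat_ne_zero, not_false_eq_true, zero_pow, Finset.sum_const_zero]
    positivity

lemma lintegral_pi_prod {ι : Type*} [Fintype ι] {Ω : ι → Type*} {mΩ : ∀ i, MeasurableSpace (Ω i)}
    {μ : (i : ι) → Measure (Ω i)} [∀ i, IsProbabilityMeasure (μ i)] {f : (i : ι) → Ω i → ℝ≥0∞}
    (hf : ∀ i, Measurable (f i)) :
    ∫⁻ x, ∏ i, f i (x i) ∂Measure.pi μ = ∏ i, ∫⁻ x, f i x ∂μ i := by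
  rw [lintegral_prod_eq_prod_lintegral_of_indepFun Finset.univ (fun i (x : (i : ι) → Ω i) => f i (x i))
    (iIndepFun_pi fun i => (hf i).aemeasurable) fun i => (hf i).comp (measurable_pi_apply i)]
  exact Finset.prod_congr rfl fun i _ => (measurePreserving_eval μ i).lintegral_comp (hf i)

lemma pi_eq_withDensity {ι : Type*} [Fintype ι] {Ω : ι → Type*}
    {mΩ : ∀ i, MeasurableSpace (Ω i)} {μ ν : (i : ι) → Measure (Ω i)}
    [∀ i, IsProbabilityMeasure (μ i)] [∀ i, IsProbabilityMeasure (ν i)]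
    {f : (i : ι) → Ω i → ℝ≥0∞} (hf : ∀ i, Measurable (f i))
    (h : ∀ i, μ i = (ν i).withDensity (f i)) :
    Measure.pi μ = (Measure.pi ν).withDensity fun x => ∏ i, f i (x i) := by
  refine Measure.pi_eq fun s hs => ?_
  have hbox : MeasurableSet (Set.univ.pi s) := MeasurableSet.univ_pi hs
  have hind : ∀ x, (Set.univ.pi s).indicator (fun x => ∏ i, f i (x i)) x =
      ∏ i, (s i).indicator (f i) (x i) := by
    intro x
    by_cases hx : x ∈ Set.univ.pi s
    · rw [Set.indicator_of_mem hx]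
      exact Finset.prod_congr rfl fun i _ => (Set.indicator_of_mem (hx i trivial) _).symm
    · rw [Set.indicator_of_notMem hx]
      obtain ⟨i, hi⟩ : ∃ i, x i ∉ s i := by simpa using hx
      exact (Finset.prod_eq_zero (Finset.mem_univ i) (Set.indicator_of_notMem hi _)).symm
  rw [withDensity_apply _ hbox, ← lintegral_indicator hbox]
  simp only [hind]
  rw [lintegral_pi_prod fun i => (hf i).indicator (hs i)]
  refine Finset.prod_congr rfl fun i _ => ?_
  rw [h i, withDensity_apply _ (hs i), lintegral_indicator (hs i)]

/-- The privacy loss of a one-dimensional Gaussian shifted from mean `b` to mean `a`. -/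
noncomputable def gaussianLoss (a b : ℝ) (v : ℝ≥0) (x : ℝ) : ℝ :=
  ((x - b) ^ 2 - (x - a) ^ 2) / (2 * v)

lemma measurable_gaussianLoss (a b : ℝ) (v : ℝ≥0) : Measurable (gaussianLoss a b v) := by
  unfold gaussianLoss; fun_prop

lemma gaussianReal_eq_withDensity (a b : ℝ) {v : ℝ≥0} (hv : v ≠ 0) :
    gaussianReal a v =
      (gaussianReal b v).withDensity fun x => ENNReal.ofReal (Real.exp (gaussianLoss a b v x)) := by
  rw [gaussianReal_of_var_ne_zero a hv, gaussianReal_of_var_ne_zero b hv,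
    ← withDensity_mul _ (measurable_gaussianPDF b v)
      (measurable_gaussianLoss a b v).exp.ennreal_ofReal]
  congr 1
  ext x
  rw [Pi.mul_apply, gaussianPDF, gaussianPDF, ← ENNReal.ofReal_mul (gaussianPDFReal_nonneg _ _ _),
    gaussianPDFReal, gaussianPDFReal, mul_assoc (√_)⁻¹, ← Real.exp_add, gaussianLoss]
  congr 4
  ring

lemma exp_mul_gaussianLoss (a b : ℝ) {v : ℝ≥0} (hv : v ≠ 0) (l x : ℝ) :
    Real.exp (l * gaussianLoss a b v x) = Real.exp (l * (b ^ 2 - a ^ 2) / (2 * v)) *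
      Real.exp ((l * (a - b) / v) * x) := by
  have hv' : (v : ℝ) ≠ 0 := by exact_mod_cast hv
  rw [← Real.exp_add, gaussianLoss]
  congr 1
  field_simp
  ring

lemma integrable_exp_gaussianLoss (a b : ℝ) {v : ℝ≥0} (hv : v ≠ 0) (l : ℝ) :
    Integrable (fun x => Real.exp (l * gaussianLoss a b v x)) (gaussianReal a v) := by
  simp only [exp_mul_gaussianLoss a b hv]
  exact (integrable_exp_mul_gaussianReal _).const_mul _

lemma integral_exp_gaussianLoss (a b : ℝ) {v : ℝ≥0} (hv : v ≠ 0) (l : ℝ) :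
    ∫ x, Real.exp (l * gaussianLoss a b v x) ∂gaussianReal a v =
      Real.exp ((l + l ^ 2) * ((a - b) ^ 2 / (2 * v))) := by
  have hv' : (v : ℝ) ≠ 0 := by exact_mod_cast hv
  simp only [exp_mul_gaussianLoss a b hv]
  have h := congrFun (mgf_id_gaussianReal (μ := a) (v := v)) (l * (a - b) / v)
  simp only [mgf, id] at h
  rw [integral_const_mul, h, ← Real.exp_add]
  congr 1
  field_simp
  ring

/-- The Gaussian mechanism: product Gaussians with nearby means are
`(ε, δ)`-indistinguishable. -/
lemma pi_gaussianReal_le {k : ℕ} {a b : Fin k → ℝ} {v : ℝ≥0} (hv : v ≠ 0) {ε δ : ℝ} (hε : 0 < ε)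
    (hε1 : ε ≤ 1) (hδ : 0 < δ) (hδ2 : δ < 1 / 2)
    (h : 8 * Real.log (1 / δ) * ∑ i, (a i - b i) ^ 2 ≤ v * ε ^ 2)
    {S : Set (Fin k → ℝ)} (hS : MeasurableSet S) :
    (Measure.pi fun i => gaussianReal (a i) v) S ≤ ENNReal.ofReal (Real.exp ε) *
      (Measure.pi fun i => gaussianReal (b i) v) S + ENNReal.ofReal δ := by
  set P := Measure.pi fun i => gaussianReal (a i) v
  set Q := Measure.pi fun i => gaussianReal (b i) v
  let Z : (Fin k → ℝ) → ℝ := fun x => ∑ i, gaussianLoss (a i) (b i) v (x i)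
  have hZ : Measurable Z := Finset.measurable_fun_sum _ fun i _ =>
    (measurable_gaussianLoss _ _ _).comp (measurable_pi_apply i)
  have hPQ : P = Q.withDensity fun x => ENNReal.ofReal (Real.exp (Z x)) := by
    have h1 := pi_eq_withDensity (fun i => (measurable_gaussianLoss (a i) (b i) v).exp.ennreal_ofReal)
      fun i => gaussianReal_eq_withDensity (a i) (b i) hv
    refine h1.trans ?_
    congr 1
    ext x
    rw [← ENNReal.ofReal_prod_of_nonneg fun i _ => (Real.exp_pos _).le, ← Real.exp_sum]
  have hgood : P (S ∩ {x | Z x < ε}) ≤ ENNReal.ofReal (Real.exp ε) * Q S := by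
    have hm : MeasurableSet (S ∩ {x | Z x < ε}) := hS.inter (measurableSet_lt hZ measurable_const)
    rw [hPQ, withDensity_apply _ hm]
    calc _ ≤ ∫⁻ _ in S ∩ {x | Z x < ε}, ENNReal.ofReal (Real.exp ε) ∂Q := by
          refine setLIntegral_mono' hm fun x hx => ?_
          exact ENNReal.ofReal_le_ofReal (Real.exp_le_exp.2 (le_of_lt hx.2))
      _ = ENNReal.ofReal (Real.exp ε) * Q (S ∩ {x | Z x < ε}) := by rw [setLIntegral_const]
      _ ≤ _ := by gcongr; exact Set.inter_subset_left
  have hbad : P {x | ε ≤ Z x} ≤ ENNReal.ofReal δ := by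
    set ℓ := Real.log (1 / δ)
    have hℓ : 1 / 2 ≤ ℓ := by
      have h2 : Real.log 2 ≤ ℓ := Real.log_le_log (by norm_num) (by
        rw [le_div_iff₀ hδ]; linarith)
      linarith [Real.log_two_gt_d9]
    set t := 2 * ℓ / ε with ht
    have ht0 : 0 ≤ t := by positivity
    have hexp : ∀ x, Real.exp (t * Z x) = ∏ i, Real.exp (t * gaussianLoss (a i) (b i) v (x i)) := by
      intro x
      rw [← Real.exp_sum, Finset.mul_sum]
    have hInt : Integrable (fun x => Real.exp (t * Z x)) P := by
      simp only [hexp]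
      exact Integrable.fintype_prod fun i => integrable_exp_gaussianLoss (a i) (b i) hv t
    have hmgf : mgf Z P t = Real.exp ((t + t ^ 2) * ((∑ i, (a i - b i) ^ 2) / (2 * v))) := by
      simp only [mgf, hexp]
      rw [integral_fintype_prod_eq_prod
        (fun i y => Real.exp (t * gaussianLoss (a i) (b i) v y))]
      simp only [integral_exp_gaussianLoss _ _ hv]
      rw [← Real.exp_sum, ← Finset.mul_sum, ← Finset.sum_div]
    have hch := measure_ge_le_exp_mul_mgf ε ht0 hInt
    rw [hmgf, ← Real.exp_add] at hch
    have hη : (∑ i, (a i - b i) ^ 2) / (2 * v) ≤ ε ^ 2 / (16 * ℓ) := by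
      have hv' : (0 : ℝ) < v := by exact_mod_cast pos_iff_ne_zero.2 hv
      rw [div_le_div_iff₀ (by positivity) (by positivity)]
      linarith
    have hexpo : -t * ε + (t + t ^ 2) * ((∑ i, (a i - b i) ^ 2) / (2 * v)) ≤ Real.log δ := by
      have h1 : (t + t ^ 2) * ((∑ i, (a i - b i) ^ 2) / (2 * v)) ≤
          (t + t ^ 2) * (ε ^ 2 / (16 * ℓ)) := by gcongr
      have h2 : (t + t ^ 2) * (ε ^ 2 / (16 * ℓ)) = ε / 8 + ℓ / 4 := by
        rw [ht]; field_simp; ring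
      have h3 : t * ε = 2 * ℓ := by rw [ht]; field_simp
      have h4 : ℓ = - Real.log δ := by simp [ℓ]
      linarith
    have := hch.trans ((Real.exp_le_exp.2 hexpo).trans_eq (Real.exp_log hδ))
    rw [measureReal_def] at this
    exact (ENNReal.le_ofReal_iff_toReal_le (measure_ne_top _ _) hδ.le).2 this
  calc P S ≤ P (S ∩ {x | Z x < ε} ∪ {x | ε ≤ Z x}) := by
        refine measure_mono fun x hx => ?_
        rcases lt_or_ge (Z x) ε with h | h
        · exact Or.inl ⟨hx, h⟩
        · exact Or.inr h
    _ ≤ _ := (measure_union_le _ _).trans (add_le_add hgood hbad)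

/-- The probability simplex on `Fin k`. -/
abbrev ProbVec (k : ℕ) : Type := {q : Fin k → ℝ // (∀ i, 0 ≤ q i) ∧ ∑ i, q i = 1}

/-- Normalization of nonnegative vectors at most doubles the `ℓ1` distance to the simplex. -/
lemma exists_measurable_normalize {k : ℕ} (hk : 0 < k) :
    ∃ N : (Fin k → ℝ) → ProbVec k, Measurable N ∧ ∀ q : Fin k → ℝ, (∀ i, 0 ≤ q i) →
      ∀ p : ProbVec k, ∑ i, |p.1 i - (N q).1 i| ≤ 2 * ∑ i, |p.1 i - q i| := by
  classical
  let i₀ : Fin k := ⟨0, hk⟩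
  let r : (Fin k → ℝ) → Fin k → ℝ := fun q =>
    if (∀ i, 0 ≤ q i) ∧ 0 < ∑ i, q i then fun i => q i / ∑ j, q j else Pi.single i₀ 1
  have hr : ∀ q, (∀ i, 0 ≤ r q i) ∧ ∑ i, r q i = 1 := by
    intro q
    by_cases h : (∀ i, 0 ≤ q i) ∧ 0 < ∑ i, q i
    · simp only [r, if_pos h]
      exact ⟨fun i => div_nonneg (h.1 i) h.2.le, by rw [← Finset.sum_div, div_self h.2.ne']⟩
    · simp only [r, if_neg h]
      refine ⟨fun i => ?_, by simp⟩
      by_cases hi : i = i₀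
      · subst hi; simp
      · simp [hi]
  have hrm : Measurable r := by
    refine Measurable.ite ?_ (by fun_prop) measurable_const
    have hpos : MeasurableSet {q : Fin k → ℝ | 0 < ∑ i, q i} :=
      measurableSet_lt measurable_const (by fun_prop)
    have hnn : MeasurableSet {q : Fin k → ℝ | ∀ i, 0 ≤ q i} := by
      rw [show {q : Fin k → ℝ | ∀ i, 0 ≤ q i} = ⋂ i, {q | 0 ≤ q i} by ext; simp]
      exact MeasurableSet.iInter fun i => measurableSet_le measurable_const (measurable_pi_apply i)
    exact hnn.inter hpos
  refine ⟨fun q => ⟨r q, hr q⟩, hrm.subtype_mk, fun q hq p => ?_⟩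
  have htotal : |1 - ∑ i, q i| ≤ ∑ i, |p.1 i - q i| := by
    have h := Finset.abs_sum_le_sum_abs (fun i => p.1 i - q i) Finset.univ
    rwa [Finset.sum_sub_distrib, p.2.2] at h
  have hrq : ∑ i, |q i - r q i| = |1 - ∑ i, q i| := by
    by_cases h : (∀ i, 0 ≤ q i) ∧ 0 < ∑ i, q i
    · simp only [r, if_pos h]
      have h1 : ∀ i, |q i - q i / ∑ j, q j| = q i * (|∑ j, q j - 1| / ∑ j, q j) := by
        intro i
        have h2 := h.2.ne'
        rw [show q i - q i / ∑ j, q j = q i * ((∑ j, q j - 1) / ∑ j, q j) by field_simp,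
          abs_mul, abs_div, abs_of_nonneg (hq i), abs_of_pos h.2]
      rw [Finset.sum_congr rfl fun i _ => h1 i, ← Finset.sum_mul, mul_div_cancel₀ _ h.2.ne',
        abs_sub_comm]
    · have h0 : ∑ i, q i = 0 :=
        le_antisymm (not_lt.1 fun h' => h ⟨hq, h'⟩) (Finset.sum_nonneg fun i _ => hq i)
      have h1 : ∀ i, q i = 0 := fun i =>
        (Finset.sum_eq_zero_iff_of_nonneg fun i _ => hq i).1 h0 i (Finset.mem_univ i)
      have h2 : ∀ i, |q i - r q i| = r q i := fun i => by
        rw [h1 i, zero_sub, abs_neg, abs_of_nonneg ((hr q).1 i)]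
      rw [Finset.sum_congr rfl fun i _ => h2 i, (hr q).2, h0]
      simp
  calc ∑ i, |p.1 i - r q i| ≤ ∑ i, (|p.1 i - q i| + |q i - r q i|) :=
        Finset.sum_le_sum fun i _ => abs_sub_le _ _ _
    _ = ∑ i, |p.1 i - q i| + ∑ i, |q i - r q i| := Finset.sum_add_distrib
    _ ≤ _ := by rw [hrq]; linarith

lemma integrable_sub_sq_gaussianReal (a c : ℝ) (v : ℝ≥0) :
    Integrable (fun x => (x - c) ^ 2) (gaussianReal a v) :=
  ((memLp_id_gaussianReal' 2 (by simp)).sub (memLp_const c)).integrable_sq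

lemma integral_sub_sq_gaussianReal (a c : ℝ) (v : ℝ≥0) :
    ∫ x, (x - c) ^ 2 ∂gaussianReal a v = v + (a - c) ^ 2 := by
  have hid : Integrable (fun x : ℝ => x) (gaussianReal a v) :=
    (memLp_id_gaussianReal' 1 (by simp)).integrable le_rfl
  have hvar := variance_eq_integral (X := fun x : ℝ => x) (μ := gaussianReal a v) aemeasurable_id
  rw [variance_fun_id_gaussianReal, integral_id_gaussianReal] at hvar
  have h : ∀ x : ℝ, (x - c) ^ 2 = (x - a) ^ 2 + (2 * (a - c) * x + (c ^ 2 - a ^ 2)) := fun x => by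
    ring
  simp only [h]
  have hlin : Integrable (fun x : ℝ => 2 * (a - c) * x + (c ^ 2 - a ^ 2)) (gaussianReal a v) :=
    (hid.const_mul _).add (integrable_const _)
  rw [integral_add (integrable_sub_sq_gaussianReal a a v) hlin, integral_add (hid.const_mul _) (integrable_const _), integral_const_mul,
    integral_id_gaussianReal, ← hvar]
  simp only [integral_const, probReal_univ, one_smul]
  ring

/-- Release the averaged square-root counts with Gaussian noise, then invert coordinatewise
by `ψ` and normalize by `N`. -/
noncomputable def sqrtMechanism {k m s : ℕ} (N : (Fin k → ℝ) → ProbVec k) (ψ : ℝ → ℝ)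
    (U : Finset (Fin s)) (v : ℝ≥0) (D : Fin s → Fin m → Fin k) : Measure (ProbVec k) :=
  (Measure.pi fun i => gaussianReal (sqrtCountAvg U D i) v).map fun y => N fun i => ψ (y i)

/-- The final arithmetic behind the accuracy of `sqrtMechanism`. -/
lemma sum_error_le {k m n : ℕ} (hm : 0 < m) (hmk : m ≤ k) (hn : 0 < n) {v α : ℝ}
    (hv : 0 < v) (hα : 0 < α) (hα1 : α < 1) {x V : Fin k → ℝ} (hx0 : ∀ i, 0 ≤ x i)
    (hx1 : ∑ i, x i = 1) (hV : ∀ i, V i ≤ m * x i)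
    (hV' : ∀ i, V i ≤ 2 * (m * x i) / (m * x i + 1))
    (hQ : (k : ℝ) ^ 2 * v / m ^ 2 + k / (m * n) ≤ α ^ 2 / 100)
    {t : Fin k → ℝ} (ht : ∀ i, t i = √(v + 2 * (m * x i) / (m * x i + 1) / n)) :
    ∑ i, ((2 * (√(m * x i + 1) / (m * t i) + 4 / m)) * (v + V i / n)
      + 2 / m * √(m * x i + 1) * t i) ≤ α := by
  have hm' : (0 : ℝ) < m := by exact_mod_cast hm
  have hn' : (0 : ℝ) < n := by exact_mod_cast hn
  have hmk' : (m : ℝ) ≤ k := by exact_mod_cast hmk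
  have hk' : (0 : ℝ) < k := hm'.trans_le hmk'
  let w : Fin k → ℝ := fun i => v * (m * x i + 1) + 2 * (m * x i) / n
  have hterm : ∀ i, (2 * (√(m * x i + 1) / (m * t i) + 4 / m)) * (v + V i / n)
      + 2 / m * √(m * x i + 1) * t i ≤ 4 / m * √(w i) + 8 / m * (v + m * x i / n) := by
    intro i
    have hxi := hx0 i
    have hmx : 0 ≤ (m : ℝ) * x i := by positivity
    have hT : 0 < v + 2 * (m * x i) / (m * x i + 1) / n := by positivity
    have hti : 0 < t i := by rw [ht]; positivity
    have hti2 : t i ^ 2 = v + 2 * (m * x i) / (m * x i + 1) / n := by rw [ht, Real.sq_sqrt hT.le]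
    have hw : √(m * x i + 1) * t i = √(w i) := by
      rw [ht, ← Real.sqrt_mul (by positivity)]
      congr 1
      simp only [w]
      field_simp
    have h1 : v + V i / n ≤ t i ^ 2 := by rw [hti2]; gcongr; exact hV' i
    have h2 : √(m * x i + 1) / (m * t i) * (v + V i / n) ≤ 1 / m * √(w i) := by
      calc _ ≤ √(m * x i + 1) / (m * t i) * t i ^ 2 := by gcongr
        _ = 1 / m * (√(m * x i + 1) * t i) := by field_simp
        _ = _ := by rw [hw]
    have h3 : v + V i / n ≤ v + m * x i / n := by gcongr; exact hV i
    have h4 : 8 / (m : ℝ) * (v + V i / n) ≤ 8 / m * (v + m * x i / n) := by gcongr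
    calc _ = 2 * (√(m * x i + 1) / (m * t i) * (v + V i / n)) + 8 / m * (v + V i / n)
          + 2 / m * (√(m * x i + 1) * t i) := by ring
      _ ≤ 2 * (1 / m * √(w i)) + 8 / m * (v + m * x i / n) + 2 / m * √(w i) := by
        rw [hw]; gcongr
      _ = _ := by ring
  have hw0 : ∀ i, 0 ≤ w i := fun i => by have := hx0 i; positivity
  have hwsum : ∑ i, w i = v * (m + k) + 2 * m / n := by
    simp only [w]
    rw [Finset.sum_add_distrib, ← Finset.mul_sum, Finset.sum_add_distrib, ← Finset.mul_sum,
      ← Finset.sum_div, ← Finset.mul_sum, ← Finset.mul_sum, hx1]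
    simp
  have hsq : (∑ i, √(w i)) ^ 2 ≤ (m * (3 / 20 * α)) ^ 2 := by
    calc (∑ i, √(w i)) ^ 2 ≤ k * ∑ i, √(w i) ^ 2 := by
          simpa using sq_sum_le_card_mul_sum_sq (s := Finset.univ) (f := fun i => √(w i))
      _ = k * (v * (m + k) + 2 * m / n) := by
        rw [← hwsum]; congr 1; exact Finset.sum_congr rfl fun i _ => Real.sq_sqrt (hw0 i)
      _ ≤ k * (v * (k + k) + 2 * m / n) := by gcongr
      _ = 2 * m ^ 2 * ((k : ℝ) ^ 2 * v / m ^ 2 + k / (m * n)) := by field_simp; ring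
      _ ≤ 2 * m ^ 2 * (α ^ 2 / 100) := by gcongr
      _ ≤ _ := by nlinarith [mul_pos hm' hα, sq_nonneg (m * α)]
  have hsum1 : ∑ i, √(w i) ≤ m * (3 / 20 * α) := le_of_sq_le_sq hsq (by positivity)
  have hsum2 : ∑ i, (v + m * x i / n) = k * v + m / n := by
    rw [Finset.sum_add_distrib, ← Finset.sum_div, ← Finset.mul_sum, hx1]; simp
  refine (Finset.sum_le_sum fun i _ => hterm i).trans ?_
  rw [Finset.sum_add_distrib, ← Finset.mul_sum, ← Finset.mul_sum, hsum2]
  have h5 : 4 / (m : ℝ) * ∑ i, √(w i) ≤ 3 / 5 * α := by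
    calc _ ≤ 4 / (m : ℝ) * (m * (3 / 20 * α)) := by gcongr
      _ = _ := by field_simp; norm_num
  have h6 : 8 / (m : ℝ) * (k * v + m / n) ≤ 8 * ((k : ℝ) ^ 2 * v / m ^ 2 + k / (m * n)) := by
    have h7 : k * v + m / n ≤ k / m * (k * v + m / n) :=
      le_mul_of_one_le_left (by positivity) ((one_le_div hm').2 hmk')
    calc _ ≤ 8 / (m : ℝ) * (k / m * (k * v + m / n)) := by gcongr
      _ = _ := by field_simp
  nlinarith

lemma lintegral_sqrtMechanism_le {k m s : ℕ} (hm : 0 < m) (hmk : m ≤ k)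
    {N : (Fin k → ℝ) → ProbVec k} (hN : Measurable N)
    (hN' : ∀ q : Fin k → ℝ, (∀ i, 0 ≤ q i) →
      ∀ p : ProbVec k, ∑ i, |p.1 i - (N q).1 i| ≤ 2 * ∑ i, |p.1 i - q i|)
    {ψ : ℝ → ℝ} (hψ : Monotone ψ) (hψ' : ∀ y, ψ y ∈ Set.Icc (0 : ℝ) 1 ∧
      ∀ x ∈ Set.Icc (0 : ℝ) 1, |sqrtMean m (ψ y) - sqrtMean m x| ≤ |y - sqrtMean m x|)
    {U : Finset (Fin s)} (hU : U.Nonempty) {v : ℝ≥0} (hv : v ≠ 0) {α : ℝ} (hα : 0 < α)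
    (hα1 : α < 1) (hQ : (k : ℝ) ^ 2 * v / m ^ 2 + k / (m * U.card) ≤ α ^ 2 / 100)
    (p : ProbVec k) :
    ∫⁻ D, (∫⁻ q, ENNReal.ofReal (∑ i, |p.1 i - q.1 i|) ∂(sqrtMechanism N ψ U v D))
        ∂(Measure.pi fun _ : Fin s => Measure.pi fun _ : Fin m => discMeasure p.1)
      ≤ ENNReal.ofReal α := by
  have := isProbabilityMeasure_discMeasure p.2.1 p.2.2
  have hm' : (0 : ℝ) < m := by exact_mod_cast hm
  have hn' : (0 : ℝ) < U.card := by exact_mod_cast hU.card_pos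
  have hv' : (0 : ℝ) < v := by exact_mod_cast pos_iff_ne_zero.2 hv
  have hx : ∀ i, p.1 i ∈ Set.Icc (0 : ℝ) 1 := fun i =>
    ⟨p.2.1 i, (Finset.single_le_sum (fun j _ => p.2.1 j) (Finset.mem_univ i)).trans_eq p.2.2⟩
  let t : Fin k → ℝ := fun i => √(v + 2 * (m * p.1 i) / (m * p.1 i + 1) / U.card)
  have ht : ∀ i, 0 < t i := fun i => by have := (hx i).1; simp only [t]; positivity
  let c : Fin k → ℝ := fun i => 2 * (√(m * p.1 i + 1) / (m * t i) + 4 / m)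
  let d : Fin k → ℝ := fun i => 2 / m * √(m * p.1 i + 1) * t i
  let f : Fin k → ℝ := fun i => sqrtMean m (p.1 i)
  have hc : ∀ i, 0 ≤ c i := fun i => by have := ht i; positivity
  have hd : ∀ i, 0 ≤ d i := fun i => by have := ht i; positivity
  have hpost : Measurable fun y : Fin k → ℝ => N fun i => ψ (y i) :=
    hN.comp (measurable_pi_lambda _ fun i => hψ.measurable.comp (measurable_pi_apply i))
  have hloss : Measurable fun q : ProbVec k => ENNReal.ofReal (∑ i, |p.1 i - q.1 i|) := by
    refine (Finset.measurable_fun_sum _ fun i _ => ?_).ennreal_ofReal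
    exact (measurable_const.sub ((measurable_pi_apply i).comp measurable_subtype_coe)).abs
  have hpt : ∀ y : Fin k → ℝ, ∑ i, |p.1 i - (N fun i => ψ (y i)).1 i| ≤
      ∑ i, (c i * (y i - f i) ^ 2 + d i) := by
    intro y
    refine (hN' _ (fun i => (hψ' (y i)).1.1) p).trans ?_
    rw [Finset.mul_sum]
    refine Finset.sum_le_sum fun i _ => ?_
    have h1 := abs_sub_le_of_sqrtMean hm (hx i) (hψ' (y i)).1 ((hψ' (y i)).2 _ (hx i))
    set e := |y i - sqrtMean m (p.1 i)| with he
    have he2 : (y i - f i) ^ 2 = e ^ 2 := by rw [he, sq_abs]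
    have hti := ht i
    have h2 : 2 * e ≤ e ^ 2 / t i + t i := by
      rw [← sub_nonneg, show e ^ 2 / t i + t i - 2 * e = (e - t i) ^ 2 / t i by field_simp; ring]
      positivity
    rw [he2]
    calc 2 * |p.1 i - ψ (y i)|
        ≤ 2 * (1 / m * √(m * p.1 i + 1) * (2 * e) + 4 / m * e ^ 2) := by
          refine mul_le_mul_of_nonneg_left (h1.trans_eq ?_) (by norm_num); ring
      _ ≤ 2 * (1 / m * √(m * p.1 i + 1) * (e ^ 2 / t i + t i) + 4 / m * e ^ 2) := by gcongr
      _ = c i * e ^ 2 + d i := by simp only [c, d]; field_simp; ring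
  have hinner : ∀ D : Fin s → Fin m → Fin k,
      ∫⁻ q, ENNReal.ofReal (∑ i, |p.1 i - q.1 i|) ∂(sqrtMechanism N ψ U v D) ≤
        ENNReal.ofReal (∑ i, (c i * (v + (sqrtCountAvg U D i - f i) ^ 2) + d i)) := by
    intro D
    rw [sqrtMechanism, lintegral_map hloss hpost]
    refine (lintegral_mono fun y => ENNReal.ofReal_le_ofReal (hpt y)).trans_eq ?_
    have hInt : ∀ i, Integrable (fun y : Fin k → ℝ => (y i - f i) ^ 2)
        (Measure.pi fun i => gaussianReal (sqrtCountAvg U D i) v) := fun i =>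
      integrable_comp_eval (μ := fun i => gaussianReal (sqrtCountAvg U D i) v)
        (f := fun z : ℝ => (z - f i) ^ 2) (integrable_sub_sq_gaussianReal _ _ _)
    have hInt' : ∀ i, Integrable (fun y : Fin k → ℝ => c i * (y i - f i) ^ 2 + d i)
        (Measure.pi fun i => gaussianReal (sqrtCountAvg U D i) v) := fun i =>
      ((hInt i).const_mul _).add (integrable_const _)
    rw [← ofReal_integral_eq_lintegral_ofReal (integrable_finsetSum _ fun i _ => hInt' i)
      (Filter.Eventually.of_forall fun y => Finset.sum_nonneg fun i _ =>
        add_nonneg (mul_nonneg (hc i) (sq_nonneg _)) (hd i)),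
      integral_finsetSum _ fun i _ => hInt' i]
    congr 1
    refine Finset.sum_congr rfl fun i _ => ?_
    rw [integral_add ((hInt i).const_mul _) (integrable_const _), integral_const_mul,
      integral_comp_eval (μ := fun i => gaussianReal (sqrtCountAvg U D i) v)
        (f := fun z : ℝ => (z - f i) ^ 2)
        (integrable_sub_sq_gaussianReal _ _ _).aestronglyMeasurable,
      integral_sub_sq_gaussianReal]
    simp
  refine (lintegral_mono hinner).trans ?_
  rw [← ofReal_integral_eq_lintegral_ofReal Integrable.of_finite
    (Filter.Eventually.of_forall fun D => Finset.sum_nonneg fun i _ =>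
      add_nonneg (mul_nonneg (hc i) (by positivity)) (hd i)),
    integral_finsetSum _ fun i _ => Integrable.of_finite]
  refine ENNReal.ofReal_le_ofReal ?_
  refine le_trans (le_of_eq ?_) (sum_error_le hm hmk hU.card_pos hv' hα hα1 p.2.1 p.2.2
    (V := fun i => sqrtVar m (p.1 i)) (fun i => sqrtVar_le_mul m _)
    (fun i => sqrtVar_le_div m (hx i).1 (hx i).2) hQ (t := t) fun i => rfl)
  refine Finset.sum_congr rfl fun i _ => ?_
  rw [integral_add Integrable.of_finite (integrable_const _), integral_const_mul,
    integral_add (integrable_const _) Integrable.of_finite,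
    integral_sqrtCountAvg_sub_sq p.2.1 p.2.2 hU]
  simp [c, d]

lemma isProbabilityMeasure_sqrtMechanism {k m s : ℕ} {N : (Fin k → ℝ) → ProbVec k} {ψ : ℝ → ℝ}
    (hpost : Measurable fun y : Fin k → ℝ => N fun i => ψ (y i)) (U : Finset (Fin s)) (v : ℝ≥0)
    (D : Fin s → Fin m → Fin k) : IsProbabilityMeasure (sqrtMechanism N ψ U v D) :=
  Measure.isProbabilityMeasure_map hpost.aemeasurable

lemma sqrtMechanism_congr {k m s : ℕ} (N : (Fin k → ℝ) → ProbVec k) (ψ : ℝ → ℝ)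
    {U : Finset (Fin s)} (v : ℝ≥0) {D D' : Fin s → Fin m → Fin k} (h : ∀ u ∈ U, D u = D' u) :
    sqrtMechanism N ψ U v D = sqrtMechanism N ψ U v D' := by
  have : ∀ i, sqrtCountAvg U D i = sqrtCountAvg U D' i := fun i =>
    Finset.sum_congr rfl fun u hu => by rw [h u hu]
  simp only [sqrtMechanism, this]

/-- For `δ ≥ 1/2`, running a mechanism on a random half of the users is private. -/
lemma exists_mechanism_of_half_le {k m s : ℕ} (hm : 0 < m) (hmk : m ≤ k)
    {ε δ α : ℝ} (hε : 0 < ε) (hδ : 1 / 2 ≤ δ) (hα : 0 < α) (hα1 : α < 1)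
    (hs : 800 * ((k : ℝ) / (m * α ^ 2)) ≤ s) :
    ∃ A : (Fin s → Fin m → Fin k) → Measure (ProbVec k),
      (∀ D, IsProbabilityMeasure (A D)) ∧
      (∀ D D' : Fin s → Fin m → Fin k, (∃ u, ∀ v, v ≠ u → D v = D' v) →
        ∀ S : Set (ProbVec k), MeasurableSet S →
          A D S ≤ ENNReal.ofReal (Real.exp ε) * A D' S + ENNReal.ofReal δ) ∧
      (∀ p : ProbVec k,
        ∫⁻ D, (∫⁻ q, ENNReal.ofReal (∑ i, |p.1 i - q.1 i|) ∂(A D))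
            ∂(Measure.pi fun _ : Fin s => Measure.pi fun _ : Fin m => discMeasure p.1)
          ≤ ENNReal.ofReal α) := by
  have hm' : (0 : ℝ) < m := by exact_mod_cast hm
  have hmk' : (m : ℝ) ≤ k := by exact_mod_cast hmk
  have hk' : (0 : ℝ) < k := hm'.trans_le hmk'
  obtain ⟨N, hN, hN'⟩ := exists_measurable_normalize (hm.trans_le hmk)
  obtain ⟨ψ, hψ, hψ'⟩ := exists_monotone_sqrtMean_inverse hm
  have hpost : Measurable fun y : Fin k → ℝ => N fun i => ψ (y i) :=
    hN.comp (measurable_pi_lambda _ fun i => hψ.measurable.comp (measurable_pi_apply i))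
  let v : ℝ≥0 := ⟨m ^ 2 * α ^ 2 / (200 * k ^ 2), by positivity⟩
  have hv : v ≠ 0 := by
    have : (0 : ℝ) < v := by
      change (0 : ℝ) < m ^ 2 * α ^ 2 / (200 * k ^ 2)
      positivity
    exact_mod_cast this.ne'
  have hs2 : 2 ≤ s := by
    have h1 : (1 : ℝ) ≤ k / (m * α ^ 2) := by
      rw [le_div_iff₀ (by positivity), one_mul]
      have hmk' : (m : ℝ) ≤ k := by exact_mod_cast hmk
      exact (mul_le_of_le_one_right (by positivity) (pow_le_one₀ hα.le hα1.le)).trans hmk'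
    have : (2 : ℝ) ≤ s := by linarith
    exact_mod_cast this
  obtain ⟨U, -, hU⟩ := Finset.exists_subset_card_eq (s := (Finset.univ : Finset (Fin s)))
    (n := s / 2) (by simpa using Nat.div_le_self s 2)
  have hUc : Uᶜ.card = s - s / 2 := by rw [Finset.card_compl, hU, Fintype.card_fin]
  have hacc : ∀ W : Finset (Fin s), s ≤ 4 * W.card → ∀ p : ProbVec k,
      ∫⁻ D, (∫⁻ q, ENNReal.ofReal (∑ i, |p.1 i - q.1 i|) ∂(sqrtMechanism N ψ W v D))
        ∂(Measure.pi fun _ : Fin s => Measure.pi fun _ : Fin m => discMeasure p.1)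
        ≤ ENNReal.ofReal α := by
    intro W hW
    have hWpos : 0 < W.card := by omega
    refine lintegral_sqrtMechanism_le hm hmk hN hN' hψ hψ' (Finset.card_pos.1 hWpos) hv hα hα1 ?_
    have hW' : (s : ℝ) ≤ 4 * W.card := by exact_mod_cast hW
    have hWr : (0 : ℝ) < W.card := by exact_mod_cast hWpos
    have h1 : (k : ℝ) ^ 2 * v / m ^ 2 = α ^ 2 / 200 := by
      change (k : ℝ) ^ 2 * (m ^ 2 * α ^ 2 / (200 * k ^ 2)) / m ^ 2 = _
      field_simp
    have h2 : (k : ℝ) / (m * W.card) ≤ α ^ 2 / 200 := by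
      have h3 := hs.trans hW'
      rw [mul_div_assoc', div_le_iff₀ (by positivity)] at h3
      rw [div_le_iff₀ (by positivity)]
      nlinarith
    linarith
  have hprob : ∀ W D, IsProbabilityMeasure (sqrtMechanism (m := m) (s := s) N ψ W v D) :=
    fun W D => isProbabilityMeasure_sqrtMechanism hpost W v D
  refine ⟨fun D => (2⁻¹ : ℝ≥0∞) • sqrtMechanism N ψ U v D +
    (2⁻¹ : ℝ≥0∞) • sqrtMechanism N ψ Uᶜ v D, fun D => ⟨?_⟩, ?_, fun p => ?_⟩
  · simp [ENNReal.inv_two_add_inv_two]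
  · rintro D D' ⟨u, hu⟩ S -
    have hhalf : (2⁻¹ : ℝ≥0∞) ≤ ENNReal.ofReal δ := by
      rw [← ENNReal.ofReal_ofNat, ← ENNReal.ofReal_inv_of_pos (by norm_num)]
      exact ENNReal.ofReal_le_ofReal (by linarith)
    have hone : (1 : ℝ≥0∞) ≤ ENNReal.ofReal (Real.exp ε) := by
      rw [← ENNReal.ofReal_one]
      exact ENNReal.ofReal_le_ofReal (Real.one_le_exp hε.le)
    have hle : ∀ W : Finset (Fin s), (2⁻¹ : ℝ≥0∞) * sqrtMechanism N ψ W v D S ≤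
        ENNReal.ofReal δ := fun W => (mul_le_of_le_one_right' prob_le_one).trans hhalf
    refine le_trans ?_ (add_le_add_left (le_mul_of_one_le_left' hone) _)
    simp only [Measure.add_apply, Measure.smul_apply, smul_eq_mul]
    by_cases huU : u ∈ U
    · have h1 : sqrtMechanism N ψ Uᶜ v D = sqrtMechanism N ψ Uᶜ v D' :=
        sqrtMechanism_congr N ψ v fun w hw => hu w (by
          rintro rfl; exact (Finset.mem_compl.1 hw) huU)
      rw [h1, add_comm]
      exact add_le_add le_add_self (hle U)
    · have h1 : sqrtMechanism N ψ U v D = sqrtMechanism N ψ U v D' :=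
        sqrtMechanism_congr N ψ v fun w hw => hu w (by rintro rfl; exact huU hw)
      rw [h1]
      exact add_le_add le_self_add (hle Uᶜ)
  · simp only [lintegral_add_measure, lintegral_smul_measure, smul_eq_mul]
    have := isProbabilityMeasure_discMeasure p.2.1 p.2.2
    rw [lintegral_add_left (measurable_of_finite _), lintegral_const_mul _ (measurable_of_finite _),
      lintegral_const_mul _ (measurable_of_finite _)]
    calc _ ≤ 2⁻¹ * ENNReal.ofReal α + 2⁻¹ * ENNReal.ofReal α :=
          add_le_add (mul_le_mul_right (hacc U (by omega) p) _)
            (mul_le_mul_right (hacc Uᶜ (by omega) p) _)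
      _ = ENNReal.ofReal α := by rw [← add_mul, ENNReal.inv_two_add_inv_two, one_mul]

/-- For `δ < 1/2`, the Gaussian mechanism on the square-root counts of all users is private. -/
lemma exists_mechanism_of_lt_half {k m s : ℕ} (hm : 0 < m) (hs0 : 0 < s) (hmk : m ≤ k)
    {ε δ α : ℝ} (hε : 0 < ε) (hε1 : ε ≤ 1) (hδ : 0 < δ) (hδ2 : δ < 1 / 2) (hα : 0 < α)
    (hα1 : α < 1)
    (hs : 800 * ((k : ℝ) / (m * α ^ 2)) ≤ s)
    (hs' : 800 * ((k : ℝ) / (√m * ε * α) * √(Real.log (1 / δ))) ≤ s) :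
    ∃ A : (Fin s → Fin m → Fin k) → Measure (ProbVec k),
      (∀ D, IsProbabilityMeasure (A D)) ∧
      (∀ D D' : Fin s → Fin m → Fin k, (∃ u, ∀ v, v ≠ u → D v = D' v) →
        ∀ S : Set (ProbVec k), MeasurableSet S →
          A D S ≤ ENNReal.ofReal (Real.exp ε) * A D' S + ENNReal.ofReal δ) ∧
      (∀ p : ProbVec k,
        ∫⁻ D, (∫⁻ q, ENNReal.ofReal (∑ i, |p.1 i - q.1 i|) ∂(A D))
            ∂(Measure.pi fun _ : Fin s => Measure.pi fun _ : Fin m => discMeasure p.1)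
          ≤ ENNReal.ofReal α) := by
  have hm' : (0 : ℝ) < m := by exact_mod_cast hm
  have hs0' : (0 : ℝ) < s := by exact_mod_cast hs0
  have hmk' : (m : ℝ) ≤ k := by exact_mod_cast hmk
  have hk' : (0 : ℝ) < k := hm'.trans_le hmk'
  have hlog : 0 < Real.log (1 / δ) := Real.log_pos (by rw [lt_div_iff₀ hδ]; linarith)
  obtain ⟨N, hN, hN'⟩ := exists_measurable_normalize (hm.trans_le hmk)
  obtain ⟨ψ, hψ, hψ'⟩ := exists_monotone_sqrtMean_inverse hm
  have hpost : Measurable fun y : Fin k → ℝ => N fun i => ψ (y i) :=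
    hN.comp (measurable_pi_lambda _ fun i => hψ.measurable.comp (measurable_pi_apply i))
  let v : ℝ≥0 := ⟨16 * m * Real.log (1 / δ) / (s ^ 2 * ε ^ 2), by positivity⟩
  have hvv : (v : ℝ) = 16 * m * Real.log (1 / δ) / (s ^ 2 * ε ^ 2) := rfl
  have hv : v ≠ 0 := by
    have : (0 : ℝ) < v := by rw [hvv]; positivity
    exact_mod_cast this.ne'
  have hne : (Finset.univ : Finset (Fin s)).Nonempty := ⟨⟨0, hs0⟩, Finset.mem_univ _⟩
  refine ⟨sqrtMechanism N ψ Finset.univ v,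
    fun D => isProbabilityMeasure_sqrtMechanism hpost _ v D, ?_,
    lintegral_sqrtMechanism_le hm hmk hN hN' hψ hψ' hne hv hα hα1 ?_⟩
  · rintro D D' ⟨u, hu⟩ S hS
    rw [sqrtMechanism, sqrtMechanism, Measure.map_apply hpost hS, Measure.map_apply hpost hS]
    refine pi_gaussianReal_le hv hε hε1 hδ hδ2 ?_ (hpost hS)
    have h := sum_sqrtCountAvg_sub_sq_le Finset.univ hu
    rw [Finset.card_univ, Fintype.card_fin] at h
    calc _ ≤ 8 * Real.log (1 / δ) * (2 * m / (s : ℝ) ^ 2) := by gcongr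
      _ = v * ε ^ 2 := by rw [hvv]; field_simp; norm_num
  · rw [Finset.card_univ, Fintype.card_fin]
    have h1 : (k : ℝ) / (m * s) ≤ α ^ 2 / 800 := by
      rw [mul_div_assoc', div_le_iff₀ (by positivity)] at hs
      rw [div_le_iff₀ (by positivity)]
      nlinarith
    have h2 : (k : ℝ) ^ 2 * v / m ^ 2 =
        16 * α ^ 2 * ((k : ℝ) / (√m * ε * α) * √(Real.log (1 / δ)) / s) ^ 2 := by
      rw [hvv, div_pow _ (s : ℝ), mul_pow _ (√(Real.log (1 / δ))), Real.sq_sqrt hlog.le, div_pow,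
        mul_pow, mul_pow, Real.sq_sqrt hm'.le]
      field_simp
    have h3 : (k : ℝ) / (√m * ε * α) * √(Real.log (1 / δ)) / s ≤ 1 / 800 := by
      rw [div_le_iff₀ hs0']; linarith
    have h4 : (k : ℝ) ^ 2 * v / m ^ 2 ≤ 16 * α ^ 2 * (1 / 800) ^ 2 := by
      rw [h2]; gcongr
    nlinarith [sq_nonneg α]

/-- sparse regime upper bound.  There is a universal constant `C > 0` such that
for `k ≥ m`, if `s ≥ C log(km/α) (k/(mα²) + (k/(√m ε α))√(log(1/δ)))`, then there is an
(ε,δ)-DP (user-level) mechanism whose expected ℓ1 error is at most `α` for every underlying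
distribution `p ∈ Δ_k`. -/
theorem stmt18 : ∃ C : ℝ, 0 < C ∧
    ∀ (k m s : ℕ), 0 < k → 0 < m → 0 < s → m ≤ k →
    ∀ ε δ α : ℝ, 0 < ε → ε ≤ 1 → 0 < δ → δ < 1 → 0 < α → α < 1 →
    C * Real.log ((k : ℝ) * m / α) *
        ((k : ℝ) / (m * α ^ 2) +
          (k : ℝ) / (Real.sqrt m * ε * α) * Real.sqrt (Real.log (1 / δ))) ≤ (s : ℝ) →
    ∃ A : (Fin s → Fin m → Fin k) →
        Measure {q : Fin k → ℝ // (∀ i, 0 ≤ q i) ∧ ∑ i, q i = 1},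
      (∀ D, IsProbabilityMeasure (A D)) ∧
      (∀ D D' : Fin s → Fin m → Fin k, (∃ u, ∀ v, v ≠ u → D v = D' v) →
        ∀ S : Set {q : Fin k → ℝ // (∀ i, 0 ≤ q i) ∧ ∑ i, q i = 1}, MeasurableSet S →
          A D S ≤ ENNReal.ofReal (Real.exp ε) * A D' S + ENNReal.ofReal δ) ∧
      (∀ p : {p : Fin k → ℝ // (∀ i, 0 ≤ p i) ∧ ∑ i, p i = 1},
        ∫⁻ D, (∫⁻ q, ENNReal.ofReal (∑ i, |p.1 i - q.1 i|) ∂(A D))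
            ∂(Measure.pi fun _ : Fin s => Measure.pi fun _ : Fin m => discMeasure p.1)
          ≤ ENNReal.ofReal α) := by
  refine ⟨1600, by norm_num, ?_⟩
  intro k m s hk hm hs hmk ε δ α hε hε1 hδ hδ1 hα hα1 hsC
  rcases Nat.lt_or_eq_of_le (Nat.succ_le_of_lt hk) with hk2 | hk1
  case inr =>
    subst hk1
    let q₀ : ProbVec 1 := ⟨fun _ => 1, fun _ => zero_le_one, by simp⟩
    refine ⟨fun _ => Measure.dirac q₀, fun _ => inferInstance, fun D D' _ S _ => ?_, fun p => ?_⟩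
    · refine le_add_right (le_mul_of_one_le_left' ?_)
      rw [← ENNReal.ofReal_one]
      exact ENNReal.ofReal_le_ofReal (Real.one_le_exp hε.le)
    · have hp : |p.1 0 - q₀.1 0| = 0 := by
        have h1 := p.2.2
        simp only [Nat.succ_eq_add_one, Nat.reduceAdd, Fin.sum_univ_one] at h1
        rw [h1, sub_self, abs_zero]
      simp [hp]
  have hk2' : (2 : ℝ) ≤ k := by exact_mod_cast hk2
  have hm1 : (1 : ℝ) ≤ m := by exact_mod_cast hm
  have hL : 1 / 2 ≤ Real.log ((k : ℝ) * m / α) := by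
    have h : Real.log 2 ≤ Real.log ((k : ℝ) * m / α) :=
      Real.log_le_log (by norm_num) (by rw [le_div_iff₀ hα]; nlinarith)
    linarith [Real.log_two_gt_d9]
  have ha : 0 ≤ (k : ℝ) / (m * α ^ 2) := by positivity
  have hb : 0 ≤ (k : ℝ) / (√m * ε * α) * √(Real.log (1 / δ)) := by positivity
  have hsum : 800 * ((k : ℝ) / (m * α ^ 2) + (k : ℝ) / (√m * ε * α) * √(Real.log (1 / δ))) ≤ s :=
    le_trans (mul_le_mul_of_nonneg_right (by linarith) (add_nonneg ha hb)) hsC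
  rcases lt_or_ge δ (1 / 2) with h | h
  · exact exists_mechanism_of_lt_half hm hs hmk hε hε1 hδ h hα hα1 (by linarith) (by linarith)
  · exact exists_mechanism_of_half_le hm hmk hε h hα hα1 (by linarith)
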